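/- Let a, b, c > 0 be real numbers with a > b and c ≥ Γ(b)/Γ(a). Then the function h_{a,b;c}(x) = (c·Γ(x+a)/Γ(x+b))^{1/x} is logarithmically completely monotonic on (0,∞); that is, for every integer k ≥ 1 and every x > 0, (−1)^k · (d^k/dx^k)[ln h_{a,b;c}(x)] ≥ 0. -/

import Mathlib

open Real

open MeasureTheory ProbabilityTheory Set Filter Topology

lemma lintegral_exp_neg_mul_Ioi {s : ℝ} (hs : 0 < s) :
    ∫⁻ t in Ioi (0 : ℝ), ENNReal.ofReal (exp (-s * t)) = ENNReal.ofReal (1 / s) := by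
  rw [← ofReal_integral_eq_lintegral_ofReal (exp_neg_integrableOn_Ioi 0 hs)
    (ae_of_all _ fun t => (exp_pos _).le), integral_exp_mul_Ioi (by linarith)]
  simp

/-- A nonnegative function that agrees on `(0, ∞)` with the moment generating function of a
nonpositive random variable satisfies the sign conditions of complete monotonicity. -/
lemma neg_one_pow_mul_iteratedDeriv_nonneg_of_lintegral_exp {Ω : Type*} [MeasurableSpace Ω]
    {μ : Measure Ω} {X : Ω → ℝ} {f : ℝ → ℝ} (hX : Measurable X) (hX0 : ∀ᵐ ω ∂μ, X ω ≤ 0)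
    (hf0 : ∀ x, 0 < x → 0 ≤ f x)
    (hf : ∀ x, 0 < x → ∫⁻ ω, ENNReal.ofReal (exp (x * X ω)) ∂μ = ENNReal.ofReal (f x))
    (k : ℕ) {x : ℝ} (hx : 0 < x) : 0 ≤ (-1 : ℝ) ^ k * iteratedDeriv k f x := by
  have hsub : Ioi 0 ⊆ integrableExpSet X μ := by
    intro y hy
    refine ⟨by fun_prop, ?_⟩
    rw [hasFiniteIntegral_iff_ofReal (ae_of_all _ fun ω => (exp_pos _).le), hf y hy]
    exact ENNReal.ofReal_lt_top
  have hmgf : f =ᶠ[𝓝 x] mgf X μ := by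
    filter_upwards [Ioi_mem_nhds hx] with y hy
    rw [mgf, integral_eq_lintegral_of_nonneg_ae (ae_of_all _ fun ω => (exp_pos _).le)
      (by fun_prop), hf y hy, ENNReal.toReal_ofReal (hf0 y hy)]
  rw [hmgf.iteratedDeriv_eq k,
    iteratedDeriv_mgf (interior_mono hsub (by rwa [interior_Ioi])) k, ← integral_const_mul]
  refine integral_nonneg_of_ae ?_
  filter_upwards [hX0] with ω hω
  rw [← mul_assoc, ← mul_pow]
  exact mul_nonneg (pow_nonneg (by linarith) k) (exp_pos _).le

/-- A Stieltjes transform of a measure on `[0, ∞)` satisfies the sign conditions of complete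
monotonicity. -/
lemma neg_one_pow_mul_iteratedDeriv_nonneg_of_stieltjes {ν : Measure ℝ} [SFinite ν] {f : ℝ → ℝ}
    (hν : ∀ᵐ u ∂ν, 0 ≤ u) (hf0 : ∀ x, 0 < x → 0 ≤ f x)
    (hf : ∀ x, 0 < x → ∫⁻ u, ENNReal.ofReal (1 / (x + u)) ∂ν = ENNReal.ofReal (f x))
    (k : ℕ) {x : ℝ} (hx : 0 < x) : 0 ≤ (-1 : ℝ) ^ k * iteratedDeriv k f x := by
  refine neg_one_pow_mul_iteratedDeriv_nonneg_of_lintegral_exp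
    (μ := (ν.prod (volume.restrict (Ioi (0 : ℝ)))).withDensity
      fun p => ENNReal.ofReal (exp (-p.1 * p.2)))
    (X := fun p => -|p.2|) (by fun_prop) (ae_of_all _ fun p => by simp) hf0 ?_ k hx
  intro y hy
  rw [lintegral_withDensity_eq_lintegral_mul _ (by fun_prop) (by fun_prop),
    lintegral_prod _ (by fun_prop), ← hf y hy]
  refine lintegral_congr_ae ?_
  filter_upwards [hν] with u hu
  rw [← lintegral_exp_neg_mul_Ioi (by linarith : 0 < y + u)]
  refine setLIntegral_congr_fun measurableSet_Ioi fun t ht => ?_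
  simp only [Pi.mul_apply]
  rw [← ENNReal.ofReal_mul (exp_pos _).le, ← exp_add, abs_of_pos ht]
  congr 2
  ring

lemma lintegral_Ioc_inv_mul_inv_add {p q x : ℝ} (hp : 0 < p) (hpq : p ≤ q) (hx : 0 < x) :
    ∫⁻ u in Ioc p q, ENNReal.ofReal (1 / u) * ENNReal.ofReal (1 / (x + u)) =
      ENNReal.ofReal ((log (x + p) - log (x + q) - log p + log q) / x) ∧
      0 ≤ (log (x + p) - log (x + q) - log p + log q) / x := by
  have hpos : ∀ u ∈ uIcc p q, 0 < u := fun u hu => by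
    rw [uIcc_of_le hpq] at hu
    exact hp.trans_le hu.1
  have hint : IntervalIntegrable (fun u => 1 / u * (1 / (x + u))) volume p q := by
    refine ContinuousOn.intervalIntegrable fun u hu => ContinuousAt.continuousWithinAt ?_
    have hu := hpos u hu
    have hxu : x + u ≠ 0 := by positivity
    have hu' := hu.ne'
    fun_prop (disch := assumption)
  have hval : ∫ u in p..q, 1 / u * (1 / (x + u)) =
      (log (x + p) - log (x + q) - log p + log q) / x := by
    rw [intervalIntegral.integral_eq_sub_of_hasDerivAt
      (f := fun u => (log u - log (x + u)) / x) (fun u hu => ?_) hint]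
    · ring
    · have hu := hpos u hu
      have hxu : 0 < x + u := by positivity
      refine HasDerivAt.congr_deriv (((hasDerivAt_log hu.ne').sub
        (((hasDerivAt_id' u).const_add x).log hxu.ne')).div_const x) ?_
      field_simp
      ring
  have hnn : 0 ≤ᵐ[volume.restrict (Ioc p q)] fun u => 1 / u * (1 / (x + u)) := by
    filter_upwards [ae_restrict_mem measurableSet_Ioc] with u hu
    have : 0 < u := hp.trans hu.1
    simp only [Pi.zero_apply]
    positivity
  rw [← hval, intervalIntegral.integral_of_le hpq]
  refine ⟨?_, integral_nonneg_of_ae hnn⟩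
  rw [ofReal_integral_eq_lintegral_ofReal hint.1 hnn]
  refine setLIntegral_congr_fun measurableSet_Ioc fun u hu => ?_
  have : 0 < u := hp.trans hu.1
  exact (ENNReal.ofReal_mul (by positivity)).symm

lemma tendsto_sum_log_sub_log_Gamma {a b x : ℝ} (ha : 0 < a) (hb : 0 < b) (hx : 0 < x) :
    Tendsto (fun n : ℕ => ∑ m ∈ Finset.range n,
      (log (x + (b + m)) - log (x + (a + m)) - log (b + m) + log (a + m))) atTop
      (𝓝 (log (Gamma (x + a)) - log (Gamma (x + b)) - log (Gamma a) + log (Gamma b))) := by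
  rw [← tendsto_add_atTop_iff_nat 1]
  refine ((((BohrMollerup.tendsto_log_gamma (add_pos hx ha)).sub
    (BohrMollerup.tendsto_log_gamma (add_pos hx hb))).sub
    (BohrMollerup.tendsto_log_gamma ha)).add (BohrMollerup.tendsto_log_gamma hb)).congr
    fun n => ?_
  simp only [BohrMollerup.logGammaSeq, Finset.sum_add_distrib, Finset.sum_sub_distrib, add_assoc]
  ring

theorem stmt_0 (a b c : ℝ) (ha : 0 < a) (hb : 0 < b) (hc : 0 < c)
    (hab : b < a) (hcge : Real.Gamma b / Real.Gamma a ≤ c) :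
    ∀ k : ℕ, 1 ≤ k → ∀ x : ℝ, 0 < x →
      0 ≤ (-1 : ℝ) ^ k *
        iteratedDeriv k
          (fun y : ℝ => Real.log ((c * Real.Gamma (y + a) / Real.Gamma (y + b)) ^ (1 / y))) x := by
  intro k _ x hx
  have hGa := Gamma_pos_of_pos ha
  have hGb := Gamma_pos_of_pos hb
  set C : ℝ := log c + log (Gamma a) - log (Gamma b) with hC
  have hC0 : 0 ≤ C := by
    have := log_le_log (by positivity) hcge
    rw [log_div hGb.ne' hGa.ne'] at this
    linarith
  have hterm (y : ℝ) (hy : 0 < y) (m : ℕ) :=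
    lintegral_Ioc_inv_mul_inv_add (p := b + m) (q := a + m) (by positivity) (by linarith) hy
  have hsum (y : ℝ) (hy : 0 < y) : HasSum (fun m : ℕ =>
      (log (y + (b + m)) - log (y + (a + m)) - log (b + m) + log (a + m)) / y)
      ((log (Gamma (y + a)) - log (Gamma (y + b)) - log (Gamma a) + log (Gamma b)) / y) := by
    rw [hasSum_iff_tendsto_nat_of_nonneg fun m => (hterm y hy m).2]
    simpa only [Finset.sum_div] using (tendsto_sum_log_sub_log_Gamma ha hb hy).div_const y
  have hlog (y : ℝ) (hy : 0 < y) :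
      log ((c * Gamma (y + a) / Gamma (y + b)) ^ (1 / y)) = C * (1 / y) +
        (log (Gamma (y + a)) - log (Gamma (y + b)) - log (Gamma a) + log (Gamma b)) / y := by
    have h1 := Gamma_pos_of_pos (add_pos hy ha)
    have h2 := Gamma_pos_of_pos (add_pos hy hb)
    rw [log_rpow (by positivity), log_div (by positivity) h2.ne', log_mul hc.ne' h1.ne', hC]
    ring
  have hsum0 (y : ℝ) (hy : 0 < y) := (hsum y hy).nonneg fun m => (hterm y hy m).2
  refine neg_one_pow_mul_iteratedDeriv_nonneg_of_stieltjes
    (ν := ENNReal.ofReal C • Measure.dirac 0 + Measure.sum fun m : ℕ =>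
      (volume.restrict (Ioc (b + m) (a + m))).withDensity fun u => ENNReal.ofReal (1 / u))
    ?_ (fun y hy => ?_) (fun y hy => ?_) k hx
  · rw [ae_add_measure_iff]
    refine ⟨Measure.ae_smul_measure (by simp [ae_dirac_eq]) _, ?_⟩
    rw [Measure.ae_sum_iff]
    refine fun m => (withDensity_absolutelyContinuous _ _).ae_le ?_
    filter_upwards [ae_restrict_mem measurableSet_Ioc] with u hu
    have : 0 < b + m := by positivity
    exact (this.trans hu.1).le
  · rw [hlog y hy]
    have := hsum0 y hy
    positivity
  · rw [hlog y hy, lintegral_add_measure, lintegral_smul_measure, lintegral_sum_measure,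
      lintegral_dirac' _ (by fun_prop), ENNReal.ofReal_add (by positivity) (hsum0 y hy),
      ENNReal.ofReal_mul hC0, add_zero, smul_eq_mul, ← (hsum y hy).tsum_eq,
      ENNReal.ofReal_tsum_of_nonneg (fun m => (hterm y hy m).2) (hsum y hy).summable]
    congr 2
    funext m
    rw [← (hterm y hy m).1,
      lintegral_withDensity_eq_lintegral_mul _ (by fun_prop) (by fun_prop)]
    rfl
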